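/- Let α = 2 and β > 0, let φ be an analytic self-map of the open unit disk D, and let g be analytic on D. Then the operator C_φU_g, defined by (C_φU_g f)(z) = ∫₀^{φ(z)} f(ξ) g'(ξ) dξ, is bounded from Z^2 to Z^β if and only if sup_{z∈D} (1−|z|²)^β |g'(φ(z))(φ'(z))²| / (1−|φ(z)|²) < ∞ and sup_{z∈D} (1−|z|²)^β log(2/(1−|φ(z)|²)) |g''(φ(z))(φ'(z))² + g'(φ(z))φ''(z)| < ∞. -/

import Mathlib

noncomputable section

/-- The open unit disk in the complex plane. -/
def uD : Set ℂ := Metric.ball 0 1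

/-- The Zygmund-type quantity `(1-|z|^2)^a * |f''(z)|`. -/
def zygS (a : ℝ) (f : ℂ → ℂ) (z : ℂ) : ℝ := (1 - ‖z‖ ^ 2) ^ a * ‖deriv (deriv f) z‖

/-- Membership in the Zygmund-type space `Z^a`. -/
def memZ (a : ℝ) (f : ℂ → ℂ) : Prop :=
  AnalyticOn ℂ f uD ∧ ∃ M : ℝ, ∀ z ∈ uD, zygS a f z ≤ M

/-- The Zygmund-type norm `‖f‖_{Z^a} = |f 0| + |f' 0| + sup_{z ∈ D} (1-|z|^2)^a |f''(z)|`. -/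
def zNorm (a : ℝ) (f : ℂ → ℂ) : ℝ := ‖f 0‖ + ‖deriv f 0‖ + sSup (zygS a f '' uD)

/-- Membership in the weighted space `H^∞_{v_b}` (for `u` analytic on `uD`). -/
def memHv (b : ℝ) (u : ℂ → ℂ) : Prop :=
  ∃ M : ℝ, ∀ z ∈ uD, (1 - ‖z‖ ^ 2) ^ b * ‖u z‖ ≤ M

/-- `T` is a bounded operator from `Z^a` to `Z^b`. -/
def boundedOp (a b : ℝ) (T : (ℂ → ℂ) → ℂ → ℂ) : Prop :=
  (∀ f, memZ a f → memZ b (T f)) ∧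
    ∃ C > 0, ∀ f, memZ a f → zNorm b (T f) ≤ C * zNorm a f

/-- `(C_φ U_g f)(z) = ∫₀^{φ(z)} f(ξ) g'(ξ) dξ`, parametrized along the segment from `0` to `φ z`. -/
def CphiUg (g φ : ℂ → ℂ) (f : ℂ → ℂ) : ℂ → ℂ :=
  fun z => ∫ t in (0:ℝ)..1, φ z * (f ((t : ℂ) * φ z) * deriv g ((t : ℂ) * φ z))

lemma uD_open : IsOpen uD := Metric.isOpen_ball

lemma mem_uD {z : ℂ} : z ∈ uD ↔ ‖z‖ < 1 := by simp [uD]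

lemma an_iff {f : ℂ → ℂ} : AnalyticOn ℂ f uD ↔ DifferentiableOn ℂ f uD :=
  Complex.analyticOn_iff_differentiableOn uD_open

lemma hd_of {f : ℂ → ℂ} (hf : DifferentiableOn ℂ f uD) {z : ℂ} (hz : z ∈ uD) :
    HasDerivAt f (deriv f z) z :=
  (hf.differentiableAt (uD_open.mem_nhds hz)).hasDerivAt

lemma d_of {f : ℂ → ℂ} (hf : DifferentiableOn ℂ f uD) : DifferentiableOn ℂ (deriv f) uD :=
  hf.deriv uD_open

lemma seg_mem {z : ℂ} (hz : z ∈ uD) {t : ℝ} (ht : t ∈ Set.Icc (0:ℝ) 1) : (t : ℂ) * z ∈ uD := by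
  rw [mem_uD] at *
  rw [norm_mul, Complex.norm_real, Real.norm_of_nonneg ht.1]
  nlinarith [ht.1, ht.2, norm_nonneg z]

lemma seg_deriv {F : ℂ → ℂ} {F' z : ℂ} {t : ℝ} (h : HasDerivAt F F' ((t : ℂ) * z)) :
    HasDerivAt (fun s : ℝ => F ((s : ℂ) * z)) (z * F') t := by
  have h1 : HasDerivAt (fun s : ℂ => s * z) z (t : ℂ) := by
    simpa using (hasDerivAt_id (t : ℂ)).mul_const z
  have h2 := (HasDerivAt.comp (t : ℂ) h h1).comp_ofReal
  simpa [mul_comm, Function.comp_def] using h2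

lemma op_deriv {g φ f : ℂ → ℂ} (hφ : DifferentiableOn ℂ φ uD) (hφm : Set.MapsTo φ uD uD)
    (hg : DifferentiableOn ℂ g uD) (hf : DifferentiableOn ℂ f uD) {z : ℂ} (hz : z ∈ uD) :
    HasDerivAt (CphiUg g φ f) (f (φ z) * deriv g (φ z) * deriv φ z) z := by
  have hh : DifferentiableOn ℂ (fun w => f w * deriv g w) uD := hf.mul (d_of hg)
  obtain ⟨F, hF⟩ := DifferentiableOn.isExactOn_ball (c := 0) (r := 1) hh
  have key : ∀ y ∈ uD, CphiUg g φ f y = F (φ y) - F 0 := by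
    intro y hy
    have hw := hφm hy
    have h1 : ∀ t ∈ Set.uIcc (0:ℝ) 1, HasDerivAt (fun s : ℝ => F ((s : ℂ) * φ y))
        (φ y * (f ((t : ℂ) * φ y) * deriv g ((t : ℂ) * φ y))) t := by
      intro t ht
      rw [Set.uIcc_of_le zero_le_one] at ht
      exact seg_deriv (hF _ (seg_mem hw ht))
    have h2 := intervalIntegral.integral_eq_sub_of_hasDerivAt h1 ?_
    · simpa [CphiUg] using h2
    · apply ContinuousOn.intervalIntegrable
      rw [Set.uIcc_of_le zero_le_one]
      apply ContinuousOn.mul continuousOn_const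
      apply hh.continuousOn.comp (f := fun t : ℝ => (t : ℂ) * φ y) (t := uD)
      · fun_prop
      · intro t ht
        exact seg_mem hw ht
  have h3 : HasDerivAt (fun y => F (φ y) - F 0) (f (φ z) * deriv g (φ z) * deriv φ z) z :=
    ((hF _ (hφm hz)).comp z (hd_of hφ hz)).sub_const _
  refine h3.congr_of_eventuallyEq ?_
  filter_upwards [uD_open.mem_nhds hz] with y hy using key y hy

lemma op_diff {g φ f : ℂ → ℂ} (hφ : DifferentiableOn ℂ φ uD) (hφm : Set.MapsTo φ uD uD)
    (hg : DifferentiableOn ℂ g uD) (hf : DifferentiableOn ℂ f uD) :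
    DifferentiableOn ℂ (CphiUg g φ f) uD := fun _ hz =>
  (op_deriv hφ hφm hg hf hz).differentiableAt.differentiableWithinAt

lemma op_deriv2 {g φ f : ℂ → ℂ} (hφ : DifferentiableOn ℂ φ uD) (hφm : Set.MapsTo φ uD uD)
    (hg : DifferentiableOn ℂ g uD) (hf : DifferentiableOn ℂ f uD) {z : ℂ} (hz : z ∈ uD) :
    deriv (deriv (CphiUg g φ f)) z = deriv f (φ z) * (deriv g (φ z) * (deriv φ z) ^ 2) +
      f (φ z) * (deriv (deriv g) (φ z) * (deriv φ z) ^ 2 + deriv g (φ z) * deriv (deriv φ) z) := by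
  have e : deriv (CphiUg g φ f) =ᶠ[nhds z] fun y => f (φ y) * deriv g (φ y) * deriv φ y := by
    filter_upwards [uD_open.mem_nhds hz] with y hy using (op_deriv hφ hφm hg hf hy).deriv
  rw [e.deriv_eq]
  have hp := hd_of hφ hz
  have h1 := (hd_of hf (hφm hz)).comp z hp
  have h2 := (hd_of (d_of hg) (hφm hz)).comp z hp
  have h3 := hd_of (d_of hφ) hz
  have h4 := ((h1.mul h2).mul h3).deriv
  refine Eq.trans h4 ?_
  simp only [Function.comp, Pi.mul_apply]
  ring

lemma radial {u : ℂ → ℂ} (hu : DifferentiableOn ℂ u uD) {B B' : ℝ → ℝ} (h0 : ‖u 0‖ ≤ B 0)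
    (hB : ∀ r, 0 ≤ r → r < 1 → HasDerivAt B (B' r) r)
    (hb : ∀ z ∈ uD, ‖deriv u z‖ ≤ B' ‖z‖) {z : ℂ} (hz : z ∈ uD) : ‖u z‖ ≤ B ‖z‖ := by
  have hz1 := mem_uD.1 hz
  have hr : ∀ t ∈ Set.Icc (0:ℝ) 1, 0 ≤ t * ‖z‖ ∧ t * ‖z‖ < 1 := fun t ht =>
    ⟨mul_nonneg ht.1 (norm_nonneg z), by nlinarith [ht.1, ht.2, norm_nonneg z]⟩
  have hk : ∀ t ∈ Set.Icc (0:ℝ) 1, HasDerivAt (fun s : ℝ => u ((s : ℂ) * z))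
      (z * deriv u ((t : ℂ) * z)) t := fun t ht => seg_deriv (hd_of hu (seg_mem hz ht))
  have hBk : ∀ t ∈ Set.Icc (0:ℝ) 1, HasDerivAt (fun s : ℝ => B (s * ‖z‖))
      (B' (t * ‖z‖) * ‖z‖) t := by
    intro t ht
    have h1 : HasDerivAt (fun s : ℝ => s * ‖z‖) ‖z‖ t := by
      simpa using (hasDerivAt_id t).mul_const ‖z‖
    exact HasDerivAt.comp t (hB _ (hr t ht).1 (hr t ht).2) h1
  have := image_norm_le_of_norm_deriv_right_le_deriv_boundary' (a := (0:ℝ)) (b := 1)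
    (f := fun s : ℝ => u ((s : ℂ) * z)) (f' := fun t => z * deriv u ((t : ℂ) * z))
    (B := fun s : ℝ => B (s * ‖z‖)) (B' := fun t => B' (t * ‖z‖) * ‖z‖)
    (fun t ht => (hk t ht).continuousAt.continuousWithinAt)
    (fun t ht => (hk t (Set.Ico_subset_Icc_self ht)).hasDerivWithinAt)
    (by simpa using h0)
    (fun t ht => (hBk t ht).continuousAt.continuousWithinAt)
    (fun t ht => (hBk t (Set.Ico_subset_Icc_self ht)).hasDerivWithinAt)
    (fun t ht => by
      have h1 := hb _ (seg_mem hz (Set.Ico_subset_Icc_self ht))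
      rw [norm_mul, Complex.norm_real, Real.norm_of_nonneg ht.1] at h1
      rw [norm_mul, mul_comm]
      exact mul_le_mul_of_nonneg_right h1 (norm_nonneg z))
    (Set.right_mem_Icc.2 zero_le_one)
  simpa using this

lemma zyg_nonneg {a : ℝ} {f : ℂ → ℂ} {z : ℂ} (hz : z ∈ uD) : 0 ≤ zygS a f z := by
  have := mem_uD.1 hz
  refine mul_nonneg (Real.rpow_nonneg ?_ _) (norm_nonneg _)
  nlinarith [norm_nonneg z]

lemma zyg_le {a : ℝ} {f : ℂ → ℂ} (hf : memZ a f) {z : ℂ} (hz : z ∈ uD) :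
    zygS a f z ≤ zNorm a f := by
  obtain ⟨_, M, hM⟩ := hf
  have h1 : zygS a f z ≤ sSup (zygS a f '' uD) := by
    apply le_csSup
    · refine ⟨M, ?_⟩
      rintro _ ⟨y, hy, rfl⟩
      exact hM y hy
    · exact ⟨z, hz, rfl⟩
  unfold zNorm
  linarith [norm_nonneg (f 0), norm_nonneg (deriv f 0)]

lemma zero_mem_uD : (0:ℂ) ∈ uD := by simp [mem_uD]

lemma sSup_nonneg' {a : ℝ} {f : ℂ → ℂ} : 0 ≤ sSup (zygS a f '' uD) := by
  apply Real.sSup_nonneg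
  rintro _ ⟨y, hy, rfl⟩
  exact zyg_nonneg hy

lemma zNorm_nonneg {a : ℝ} {f : ℂ → ℂ} : 0 ≤ zNorm a f := by
  unfold zNorm
  have := sSup_nonneg' (a := a) (f := f)
  positivity

lemma zNorm_le {a : ℝ} {f : ℂ → ℂ} {K0 K1 M : ℝ} (h0 : ‖f 0‖ ≤ K0) (h1 : ‖deriv f 0‖ ≤ K1)
    (hM : ∀ z ∈ uD, zygS a f z ≤ M) : zNorm a f ≤ K0 + K1 + M := by
  have : sSup (zygS a f '' uD) ≤ M := by
    apply csSup_le
    · exact ⟨_, 0, zero_mem_uD, rfl⟩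
    · rintro _ ⟨y, hy, rfl⟩
      exact hM y hy
  unfold zNorm
  linarith

lemma f1_bound {f : ℂ → ℂ} (hf : memZ 2 f) {z : ℂ} (hz : z ∈ uD) :
    ‖deriv f z‖ ≤ zNorm 2 f * (1 - ‖z‖)⁻¹ := by
  have hd := an_iff.1 hf.1
  have hN := zNorm_nonneg (a := 2) (f := f)
  refine radial (d_of hd) (B := fun r => zNorm 2 f * (1 - r)⁻¹)
    (B' := fun r => zNorm 2 f * (1 / (1 - r) ^ 2)) ?_ ?_ ?_ hz
  · have := sSup_nonneg' (a := 2) (f := f)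
    simp only [sub_zero, inv_one, mul_one]
    unfold zNorm
    linarith [norm_nonneg (f 0)]
  · intro r h0 h1
    have h2 : HasDerivAt (fun r : ℝ => 1 - r) (-1) r := by
      simpa using (hasDerivAt_id r).const_sub 1
    have h3 := (h2.inv (by linarith)).const_mul (zNorm 2 f)
    simpa using h3
  · intro y hy
    have h1 := zyg_le hf hy
    have h2 := mem_uD.1 hy
    unfold zygS at h1
    rw [Real.rpow_two] at h1
    have h3 : 0 < 1 - ‖y‖ := by linarith
    rw [mul_one_div, le_div_iff₀ (by positivity)]
    refine le_trans ?_ h1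
    rw [mul_comm]
    apply mul_le_mul_of_nonneg_right _ (norm_nonneg _)
    apply pow_le_pow_left₀ h3.le
    nlinarith [norm_nonneg y]

lemma f0_bound {f : ℂ → ℂ} (hf : memZ 2 f) {z : ℂ} (hz : z ∈ uD) :
    ‖f z‖ ≤ zNorm 2 f * (1 - Real.log (1 - ‖z‖)) := by
  have hd := an_iff.1 hf.1
  refine radial hd (B := fun r => zNorm 2 f * (1 - Real.log (1 - r)))
    (B' := fun r => zNorm 2 f * (1 - r)⁻¹) ?_ ?_ (fun y hy => f1_bound hf hy) hz
  · have := sSup_nonneg' (a := 2) (f := f)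
    simp only [sub_zero, Real.log_one, mul_one]
    unfold zNorm
    linarith [norm_nonneg (deriv f 0)]
  · intro r h0 h1
    have h2 : HasDerivAt (fun r : ℝ => 1 - r) (-1) r := by
      simpa using (hasDerivAt_id r).const_sub 1
    have h3 := ((h2.log (by linarith)).const_sub 1).const_mul (zNorm 2 f)
    rw [neg_div, neg_neg, one_div] at h3
    exact h3

lemma pos_uD {z : ℂ} (hz : z ∈ uD) : 0 < 1 - ‖z‖ ^ 2 := by
  have := mem_uD.1 hz
  nlinarith [norm_nonneg z]

lemma log_ge {z : ℂ} (hz : z ∈ uD) : 1 / 2 ≤ Real.log (2 / (1 - ‖z‖ ^ 2)) := by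
  have h := pos_uD hz
  have h1 : Real.log 2 ≤ Real.log (2 / (1 - ‖z‖ ^ 2)) := by
    apply Real.log_le_log (by norm_num)
    rw [le_div_iff₀ h]
    nlinarith [sq_nonneg ‖z‖]
  linarith [Real.log_two_gt_d9]

lemma f1_bound' {f : ℂ → ℂ} (hf : memZ 2 f) {z : ℂ} (hz : z ∈ uD) :
    ‖deriv f z‖ ≤ 2 * zNorm 2 f / (1 - ‖z‖ ^ 2) := by
  refine (f1_bound hf hz).trans ?_
  have h := pos_uD hz
  have h1 := mem_uD.1 hz
  have h2 : 0 < 1 - ‖z‖ := by linarith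
  have hN := zNorm_nonneg (a := 2) (f := f)
  rw [← div_eq_mul_inv, div_le_div_iff₀ h2 h]
  have : 1 - ‖z‖ ^ 2 ≤ 2 * (1 - ‖z‖) := by nlinarith
  nlinarith

lemma f0_bound' {f : ℂ → ℂ} (hf : memZ 2 f) {z : ℂ} (hz : z ∈ uD) :
    ‖f z‖ ≤ 3 * zNorm 2 f * Real.log (2 / (1 - ‖z‖ ^ 2)) := by
  refine (f0_bound hf hz).trans ?_
  have h := pos_uD hz
  have h1 := mem_uD.1 hz
  have h2 : 0 < 1 - ‖z‖ := by linarith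
  have hN := zNorm_nonneg (a := 2) (f := f)
  have hL := log_ge hz
  have h3 : - Real.log (1 - ‖z‖) ≤ Real.log (2 / (1 - ‖z‖ ^ 2)) := by
    rw [← Real.log_inv]
    apply Real.log_le_log (by positivity)
    rw [inv_eq_one_div, div_le_div_iff₀ h2 h]
    nlinarith
  have h4 : 1 - Real.log (1 - ‖z‖) ≤ 3 * Real.log (2 / (1 - ‖z‖ ^ 2)) := by linarith
  calc _ ≤ zNorm 2 f * (3 * Real.log (2 / (1 - ‖z‖ ^ 2))) := mul_le_mul_of_nonneg_left h4 hN
    _ = _ := by ring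

/-- Test-function estimates. -/
lemma den_bounds {w y : ℂ} (hw : w ∈ uD) (hy : y ∈ uD) :
    1 - ‖y‖ ≤ ‖1 - (starRingEnd ℂ) w * y‖ ∧ 1 - ‖w‖ ≤ ‖1 - (starRingEnd ℂ) w * y‖ := by
  have h1 := mem_uD.1 hw
  have h2 := mem_uD.1 hy
  have h3 : 1 - ‖w‖ * ‖y‖ ≤ ‖1 - (starRingEnd ℂ) w * y‖ := by
    have := norm_sub_norm_le (1:ℂ) ((starRingEnd ℂ) w * y)
    simpa [norm_mul] using this
  constructor <;> nlinarith [norm_nonneg w, norm_nonneg y]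

lemma den_ne {w y : ℂ} (hw : w ∈ uD) (hy : y ∈ uD) : 1 - (starRingEnd ℂ) w * y ≠ 0 := by
  have := (den_bounds hw hy).1
  have h2 := mem_uD.1 hy
  rw [← norm_pos_iff]
  linarith

lemma den_slit {w y : ℂ} (hw : w ∈ uD) (hy : y ∈ uD) :
    1 - (starRingEnd ℂ) w * y ∈ Complex.slitPlane := by
  left
  have h1 := mem_uD.1 hw
  have h2 := mem_uD.1 hy
  have h3 : ((starRingEnd ℂ) w * y).re ≤ ‖w‖ * ‖y‖ := by
    refine (Complex.re_le_norm _).trans ?_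
    simp [norm_mul]
  simp only [Complex.sub_re, Complex.one_re]
  nlinarith [norm_nonneg w, norm_nonneg y]

lemma den_deriv (w y : ℂ) : HasDerivAt (fun y => 1 - (starRingEnd ℂ) w * y)
    (-(starRingEnd ℂ) w) y := by
  simpa using ((hasDerivAt_id y).const_mul ((starRingEnd ℂ) w)).const_sub 1

lemma den_self (w : ℂ) : 1 - (starRingEnd ℂ) w * w = ((1 - ‖w‖ ^ 2 : ℝ) : ℂ) := by
  rw [mul_comm, Complex.mul_conj, Complex.normSq_eq_norm_sq]
  push_cast
  ring

def mob (w y : ℂ) : ℂ := (y - w) / (1 - (starRingEnd ℂ) w * y)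

lemma mob_d {w y : ℂ} (hw : w ∈ uD) (hy : y ∈ uD) :
    HasDerivAt (mob w) ((1 - (starRingEnd ℂ) w * w) / (1 - (starRingEnd ℂ) w * y) ^ 2) y := by
  have h := ((hasDerivAt_id y).sub_const w).div (den_deriv w y) (den_ne hw hy)
  refine (h.congr_deriv ?_)
  simp only [id]
  ring

lemma mob_d2 {w y : ℂ} (hw : w ∈ uD) (hy : y ∈ uD) :
    deriv (deriv (mob w)) y = 2 * (starRingEnd ℂ) w * (1 - (starRingEnd ℂ) w * w) /
      (1 - (starRingEnd ℂ) w * y) ^ 3 := by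
  have e : deriv (mob w) =ᶠ[nhds y] fun y => (1 - (starRingEnd ℂ) w * w) *
      ((1 - (starRingEnd ℂ) w * y) ^ 2)⁻¹ := by
    filter_upwards [uD_open.mem_nhds hy] with x hx
    rw [(mob_d hw hx).deriv, div_eq_mul_inv]
  have hne := den_ne hw hy
  rw [e.deriv_eq]
  have h := ((((den_deriv w y).pow 2).inv (pow_ne_zero 2 hne)).const_mul
    (1 - (starRingEnd ℂ) w * w)).deriv
  refine Eq.trans h ?_
  simp only [Pi.pow_apply]
  field_simp
  ring

lemma mob_zyg {w y : ℂ} (hw : w ∈ uD) (hy : y ∈ uD) : zygS 2 (mob w) y ≤ 16 := by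
  unfold zygS
  rw [mob_d2 hw hy, Real.rpow_two, den_self, norm_div, norm_pow, norm_mul, norm_mul,
    Complex.norm_real, Complex.norm_conj, Real.norm_of_nonneg (pos_uD hw).le]
  obtain ⟨h1, h2⟩ := den_bounds hw hy
  have h3 := mem_uD.1 hw
  have h4 := mem_uD.1 hy
  set d := ‖1 - (starRingEnd ℂ) w * y‖
  have hd : 0 < d := by linarith
  have a1 : 1 - ‖y‖ ^ 2 ≤ 2 * d := by nlinarith [norm_nonneg y]
  have a2 : 1 - ‖w‖ ^ 2 ≤ 2 * d := by nlinarith [norm_nonneg w]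
  have a3 : (1 - ‖y‖ ^ 2) ^ 2 ≤ (2 * d) ^ 2 := pow_le_pow_left₀ (pos_uD hy).le a1 2
  have a4 : ‖w‖ * (1 - ‖w‖ ^ 2) ≤ 1 * (2 * d) :=
    mul_le_mul h3.le a2 (pos_uD hw).le zero_le_one
  have a5 : (1 - ‖y‖ ^ 2) ^ 2 * (‖w‖ * (1 - ‖w‖ ^ 2)) ≤ (2 * d) ^ 2 * (1 * (2 * d)) :=
    mul_le_mul a3 a4 (mul_nonneg (norm_nonneg w) (pos_uD hw).le) (by positivity)
  rw [← mul_div_assoc, div_le_iff₀ (by positivity)]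
  have : ‖(2:ℂ)‖ = 2 := by simp
  rw [this]
  nlinarith

lemma mob_mem {w : ℂ} (hw : w ∈ uD) : memZ 2 (mob w) :=
  ⟨an_iff.2 fun _ hy => (mob_d hw hy).differentiableAt.differentiableWithinAt,
    16, fun _ hy => mob_zyg hw hy⟩

lemma mob_norm {w : ℂ} (hw : w ∈ uD) : zNorm 2 (mob w) ≤ 18 := by
  have h3 := mem_uD.1 hw
  have := zNorm_le (a := 2) (f := mob w) (K0 := 1) (K1 := 1) (M := 16) ?_ ?_
    (fun _ hy => mob_zyg hw hy)
  · linarith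
  · simpa [mob] using h3.le
  · rw [(mob_d hw zero_mem_uD).deriv, den_self, norm_div, Complex.norm_real,
      Real.norm_of_nonneg (pos_uD hw).le]
    simp

def lgt (w y : ℂ) : ℂ := (Real.log 2 : ℝ) - Complex.log (1 - (starRingEnd ℂ) w * y)

lemma lgt_d {w y : ℂ} (hw : w ∈ uD) (hy : y ∈ uD) :
    HasDerivAt (lgt w) ((starRingEnd ℂ) w / (1 - (starRingEnd ℂ) w * y)) y := by
  have h := ((den_deriv w y).clog (den_slit hw hy)).const_sub ((Real.log 2 : ℝ) : ℂ)
  rw [neg_div, neg_neg] at h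
  exact h

lemma lgt_d2 {w y : ℂ} (hw : w ∈ uD) (hy : y ∈ uD) :
    deriv (deriv (lgt w)) y = ((starRingEnd ℂ) w) ^ 2 / (1 - (starRingEnd ℂ) w * y) ^ 2 := by
  have e : deriv (lgt w) =ᶠ[nhds y] fun y => (starRingEnd ℂ) w *
      (1 - (starRingEnd ℂ) w * y)⁻¹ := by
    filter_upwards [uD_open.mem_nhds hy] with x hx
    rw [(lgt_d hw hx).deriv, div_eq_mul_inv]
  have hne := den_ne hw hy
  rw [e.deriv_eq]
  have h := (((den_deriv w y).inv hne).const_mul ((starRingEnd ℂ) w)).deriv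
  refine Eq.trans h ?_
  ring

lemma lgt_zyg {w y : ℂ} (hw : w ∈ uD) (hy : y ∈ uD) : zygS 2 (lgt w) y ≤ 4 := by
  unfold zygS
  rw [lgt_d2 hw hy, Real.rpow_two, norm_div, norm_pow, norm_pow, Complex.norm_conj]
  obtain ⟨h1, h2⟩ := den_bounds hw hy
  have h3 := mem_uD.1 hw
  have h4 := mem_uD.1 hy
  set d := ‖1 - (starRingEnd ℂ) w * y‖
  have hd : 0 < d := by linarith
  have a1 : 1 - ‖y‖ ^ 2 ≤ 2 * d := by nlinarith [norm_nonneg y]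
  have a3 : (1 - ‖y‖ ^ 2) ^ 2 ≤ (2 * d) ^ 2 := pow_le_pow_left₀ (pos_uD hy).le a1 2
  have a4 : ‖w‖ ^ 2 ≤ 1 := pow_le_one₀ (norm_nonneg w) h3.le
  have a5 : (1 - ‖y‖ ^ 2) ^ 2 * ‖w‖ ^ 2 ≤ (2 * d) ^ 2 * 1 :=
    mul_le_mul a3 a4 (by positivity) (by positivity)
  rw [← mul_div_assoc, div_le_iff₀ (by positivity)]
  nlinarith

lemma lgt_mem {w : ℂ} (hw : w ∈ uD) : memZ 2 (lgt w) :=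
  ⟨an_iff.2 fun _ hy => (lgt_d hw hy).differentiableAt.differentiableWithinAt,
    4, fun _ hy => lgt_zyg hw hy⟩

lemma lgt_norm {w : ℂ} (hw : w ∈ uD) : zNorm 2 (lgt w) ≤ 6 := by
  have h3 := mem_uD.1 hw
  have := zNorm_le (a := 2) (f := lgt w) (K0 := 1) (K1 := 1) (M := 4) ?_ ?_
    (fun _ hy => lgt_zyg hw hy)
  · linarith
  · have h : lgt w 0 = ((Real.log 2 : ℝ) : ℂ) := by simp [lgt]
    rw [h, Complex.norm_real, Real.norm_of_nonneg (Real.log_nonneg (by norm_num))]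
    linarith [Real.log_two_lt_d9]
  · rw [(lgt_d hw zero_mem_uD).deriv]
    simpa using h3.le

lemma lgt_self {w : ℂ} (hw : w ∈ uD) :
    lgt w w = ((Real.log (2 / (1 - ‖w‖ ^ 2)) : ℝ) : ℂ) := by
  unfold lgt
  rw [den_self, ← Complex.ofReal_log (pos_uD hw).le, ← Complex.ofReal_sub,
    Real.log_div (by norm_num) (pos_uD hw).ne']

lemma suff {β : ℝ} {φ g : ℂ → ℂ} (hφ : DifferentiableOn ℂ φ uD) (hφm : Set.MapsTo φ uD uD)
    (hg : DifferentiableOn ℂ g uD) {M1 M2 : ℝ}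
    (h1 : ∀ z ∈ uD, (1 - ‖z‖ ^ 2) ^ β * ‖deriv g (φ z) * (deriv φ z) ^ 2‖ / (1 - ‖φ z‖ ^ 2) ≤ M1)
    (h2 : ∀ z ∈ uD, (1 - ‖z‖ ^ 2) ^ β * Real.log (2 / (1 - ‖φ z‖ ^ 2)) *
      ‖deriv (deriv g) (φ z) * (deriv φ z) ^ 2 + deriv g (φ z) * deriv (deriv φ) z‖ ≤ M2)
    {f : ℂ → ℂ} (hf : memZ 2 f) {z : ℂ} (hz : z ∈ uD) :
    zygS β (CphiUg g φ f) z ≤ (2 * M1 + 3 * M2) * zNorm 2 f := by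
  unfold zygS
  rw [op_deriv2 hφ hφm hg (an_iff.1 hf.1) hz]
  have b1 := f1_bound' hf (hφm hz)
  have b0 := f0_bound' hf (hφm hz)
  have hN := zNorm_nonneg (a := 2) (f := f)
  have hp : 0 ≤ (1 - ‖z‖ ^ 2) ^ β := Real.rpow_nonneg (pos_uD hz).le _
  have k1 := h1 z hz
  have k2 := h2 z hz
  set A := deriv g (φ z) * (deriv φ z) ^ 2
  set Bq := deriv (deriv g) (φ z) * (deriv φ z) ^ 2 + deriv g (φ z) * deriv (deriv φ) z
  set P := (1 - ‖z‖ ^ 2) ^ β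
  set L := Real.log (2 / (1 - ‖φ z‖ ^ 2))
  set N := zNorm 2 f
  calc P * ‖deriv f (φ z) * A + f (φ z) * Bq‖
      ≤ P * ((2 * N / (1 - ‖φ z‖ ^ 2)) * ‖A‖ + (3 * N * L) * ‖Bq‖) := by
        apply mul_le_mul_of_nonneg_left _ hp
        refine (norm_add_le _ _).trans ?_
        rw [norm_mul (deriv f (φ z)), norm_mul (f (φ z))]
        gcongr
    _ = 2 * N * (P * ‖A‖ / (1 - ‖φ z‖ ^ 2)) + 3 * N * (P * L * ‖Bq‖) := by ring
    _ ≤ 2 * N * M1 + 3 * N * M2 := by gcongr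
    _ = _ := by ring

theorem stmt_9 (α β : ℝ) (hα : α = 2) (hβ : 0 < β)
    (φ g : ℂ → ℂ) (hφ : AnalyticOn ℂ φ uD) (hφm : Set.MapsTo φ uD uD)
    (hg : AnalyticOn ℂ g uD) :
    boundedOp 2 β (CphiUg g φ) ↔
      ((∃ M : ℝ, ∀ z ∈ uD, (1 - ‖z‖ ^ 2) ^ β * ‖deriv g (φ z) * (deriv φ z) ^ 2‖ / (1 - ‖φ z‖ ^ 2) ^ (1:ℝ) ≤ M) ∧ (∃ M : ℝ, ∀ z ∈ uD, (1 - ‖z‖ ^ 2) ^ β * Real.log (2 / (1 - ‖φ z‖ ^ 2)) * ‖deriv (deriv g) (φ z) * (deriv φ z) ^ 2 + deriv g (φ z) * deriv (deriv φ) z‖ ≤ M)) := by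
  have hφd := an_iff.1 hφ
  have hgd := an_iff.1 hg
  simp only [Real.rpow_one]
  constructor
  · rintro ⟨hmem, C, hC, hb⟩
    have key : ∀ f, memZ 2 f → ∀ z ∈ uD, zygS β (CphiUg g φ f) z ≤ C * zNorm 2 f :=
      fun f hf z hz => (zyg_le (hmem f hf) hz).trans (hb f hf)
    have first : ∀ z ∈ uD, (1 - ‖z‖ ^ 2) ^ β * ‖deriv g (φ z) * (deriv φ z) ^ 2‖ /
        (1 - ‖φ z‖ ^ 2) ≤ C * 18 := by
      intro z hz
      have hw := hφm hz
      have h := (key _ (mob_mem hw) z hz).trans (mul_le_mul_of_nonneg_left (mob_norm hw) hC.le)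
      unfold zygS at h
      rw [op_deriv2 hφd hφm hgd (an_iff.1 (mob_mem hw).1) hz, (mob_d hw hw).deriv] at h
      have h0 : mob (φ z) (φ z) = 0 := by simp [mob]
      have hne := den_ne hw hw
      have hd : (1 - (starRingEnd ℂ) (φ z) * φ z) / (1 - (starRingEnd ℂ) (φ z) * φ z) ^ 2 =
          (((1 - ‖φ z‖ ^ 2)⁻¹ : ℝ) : ℂ) := by
        rw [Complex.ofReal_inv, ← den_self]
        field_simp
      rw [h0, hd, zero_mul, add_zero, norm_mul, Complex.norm_real,
        Real.norm_of_nonneg (inv_nonneg.2 (pos_uD hw).le)] at h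
      refine le_trans (le_of_eq ?_) h
      ring
    refine ⟨⟨_, first⟩, C * 6 + C * 18, ?_⟩
    intro z hz
    have hw := hφm hz
    have h := (key _ (lgt_mem hw) z hz).trans (mul_le_mul_of_nonneg_left (lgt_norm hw) hC.le)
    have k1 := first z hz
    unfold zygS at h
    rw [op_deriv2 hφd hφm hgd (an_iff.1 (lgt_mem hw).1) hz, (lgt_d hw hw).deriv,
      lgt_self hw, den_self] at h
    have hp : 0 ≤ (1 - ‖z‖ ^ 2) ^ β := Real.rpow_nonneg (pos_uD hz).le _
    have hL := log_ge hw
    have hq := pos_uD hw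
    have hw1 := mem_uD.1 hw
    set A := deriv g (φ z) * (deriv φ z) ^ 2
    set Bq := deriv (deriv g) (φ z) * (deriv φ z) ^ 2 + deriv g (φ z) * deriv (deriv φ) z
    set P := (1 - ‖z‖ ^ 2) ^ β
    set L := Real.log (2 / (1 - ‖φ z‖ ^ 2))
    have e1 : ‖((L : ℝ) : ℂ) * Bq‖ = L * ‖Bq‖ := by
      rw [norm_mul, Complex.norm_real, Real.norm_of_nonneg (by linarith)]
    have e2 : ‖(starRingEnd ℂ) (φ z) / ((1 - ‖φ z‖ ^ 2 : ℝ) : ℂ) * A‖ ≤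
        ‖A‖ / (1 - ‖φ z‖ ^ 2) := by
      rw [norm_mul, norm_div, Complex.norm_conj, Complex.norm_real, Real.norm_of_nonneg hq.le,
        div_mul_eq_mul_div]
      gcongr
      nlinarith [norm_nonneg A]
    have e3 : ‖((L : ℝ) : ℂ) * Bq‖ ≤
        ‖(starRingEnd ℂ) (φ z) / ((1 - ‖φ z‖ ^ 2 : ℝ) : ℂ) * A + ((L : ℝ) : ℂ) * Bq‖ +
        ‖(starRingEnd ℂ) (φ z) / ((1 - ‖φ z‖ ^ 2 : ℝ) : ℂ) * A‖ := by
      have := norm_sub_le ((starRingEnd ℂ) (φ z) / ((1 - ‖φ z‖ ^ 2 : ℝ) : ℂ) * A +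
        ((L : ℝ) : ℂ) * Bq) ((starRingEnd ℂ) (φ z) / ((1 - ‖φ z‖ ^ 2 : ℝ) : ℂ) * A)
      rwa [add_sub_cancel_left] at this
    rw [e1] at e3
    have e4 := mul_le_mul_of_nonneg_left (e3.trans (add_le_add_right e2 _)) hp
    rw [mul_add, ← mul_div_assoc] at e4
    rw [mul_assoc]
    linarith
  · rintro ⟨⟨M1, h1⟩, M2, h2⟩
    have key := fun f (hf : memZ 2 f) z (hz : z ∈ uD) => suff hφd hφm hgd h1 h2 hf hz
    have hTm : ∀ f, memZ 2 f → memZ β (CphiUg g φ f) := fun f hf =>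
      ⟨an_iff.2 (op_diff hφd hφm hgd (an_iff.1 hf.1)), _, fun z hz => key f hf z hz⟩
    refine ⟨hTm, ?_⟩
    have hw := hφm zero_mem_uD
    have hdg := d_of hgd
    -- bound of `T f 0`
    obtain ⟨K, hK0, hK⟩ : ∃ K : ℝ, 0 ≤ K ∧ ∀ t ∈ Set.Icc (0:ℝ) 1,
        ‖deriv g ((t : ℂ) * φ 0)‖ ≤ K := by
      have hc : ContinuousOn (fun t : ℝ => deriv g ((t : ℂ) * φ 0)) (Set.Icc (0:ℝ) 1) := by
        apply hdg.continuousOn.comp (f := fun t : ℝ => (t : ℂ) * φ 0) (t := uD)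
        · fun_prop
        · intro t ht
          exact seg_mem hw ht
      obtain ⟨K, hK⟩ := isCompact_Icc.exists_bound_of_continuousOn hc
      exact ⟨K, (norm_nonneg _).trans (hK 0 (by simp)), hK⟩
    set L := Real.log (2 / (1 - ‖φ 0‖ ^ 2)) with hLdef
    have hL := log_ge hw
    have hw1 := mem_uD.1 hw
    have hf0 : ∀ f, memZ 2 f → ∀ t ∈ Set.Icc (0:ℝ) 1,
        ‖f ((t : ℂ) * φ 0)‖ ≤ 3 * zNorm 2 f * L := by
      intro f hf t ht
      have hm := seg_mem hw ht
      refine (f0_bound' hf hm).trans ?_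
      have hN := zNorm_nonneg (a := 2) (f := f)
      have hq := pos_uD hm
      have hq2 := pos_uD hw
      have hle : ‖(t : ℂ) * φ 0‖ ≤ ‖φ 0‖ := by
        rw [norm_mul, Complex.norm_real, Real.norm_of_nonneg ht.1]
        nlinarith [ht.1, ht.2, norm_nonneg (φ 0)]
      apply mul_le_mul_of_nonneg_left _ (by positivity)
      apply Real.log_le_log (by positivity)
      gcongr
    have hT0 : ∀ f, memZ 2 f → ‖CphiUg g φ f 0‖ ≤ 3 * L * K * zNorm 2 f := by
      intro f hf
      have hN := zNorm_nonneg (a := 2) (f := f)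
      have := intervalIntegral.norm_integral_le_of_norm_le_const (a := 0) (b := 1)
        (C := 3 * L * K * zNorm 2 f)
        (f := fun t : ℝ => φ 0 * (f ((t : ℂ) * φ 0) * deriv g ((t : ℂ) * φ 0))) ?_
      · simpa [CphiUg] using this
      · intro t ht
        rw [Set.uIoc_of_le zero_le_one] at ht
        have ht' := Set.Ioc_subset_Icc_self ht
        rw [norm_mul, norm_mul]
        calc _ ≤ 1 * ((3 * zNorm 2 f * L) * K) := by
              have i1 := hf0 f hf t ht'
              have i2 := hK t ht'
              gcongr
          _ = _ := by ring
    set K1 := ‖deriv g (φ 0)‖ * ‖deriv φ 0‖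
    have hT1 : ∀ f, memZ 2 f → ‖deriv (CphiUg g φ f) 0‖ ≤ 3 * L * K1 * zNorm 2 f := by
      intro f hf
      rw [(op_deriv hφd hφm hgd (an_iff.1 hf.1) zero_mem_uD).deriv, mul_assoc, norm_mul, norm_mul]
      have := f0_bound' hf hw
      calc _ ≤ (3 * zNorm 2 f * L) * K1 := by
            apply mul_le_mul_of_nonneg_right this (by positivity)
        _ = _ := by ring
    refine ⟨|3 * L * K + 3 * L * K1 + (2 * M1 + 3 * M2)| + 1, by positivity, ?_⟩
    intro f hf
    have hN := zNorm_nonneg (a := 2) (f := f)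
    refine (zNorm_le (hT0 f hf) (hT1 f hf) (fun z hz => key f hf z hz)).trans ?_
    rw [← add_mul, ← add_mul]
    apply mul_le_mul_of_nonneg_right _ hN
    linarith [le_abs_self (3 * L * K + 3 * L * K1 + (2 * M1 + 3 * M2))]
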